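/- Let X be a strongly slide-free cocompact G-tree and let Y be a cocompact G-tree obtained from X by an elementary deformation. Then Y is uniquely reducible to X: every maximal sequence of collapse moves performed on Y results in a G-tree isomorphic to X. -/

import Mathlib

universe u

/-- A `G`-tree: a simplicial tree together with an action of `G` by graph
automorphisms without inversions. -/
structure GTree (G : Type u) [Group G] : Type (u + 1) where
  V : Type u
  graph : SimpleGraph V
  isTree : graph.IsTree
  smul : G → V → V
  smul_one : ∀ x, smul 1 x = x
  smul_mul : ∀ γ δ x, smul (γ * δ) x = smul γ (smul δ x)
  smul_adj : ∀ (γ : G) ⦃x y : V⦄, graph.Adj x y → graph.Adj (smul γ x) (smul γ y)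
  no_inversions : ∀ (γ : G) (x y : V), graph.Adj x y → ¬(smul γ x = y ∧ smul γ y = x)

namespace GTree

variable {G : Type u} [Group G]

/-- Oriented edges of a `G`-tree. -/
def Edge (X : GTree G) : Type u := { p : X.V × X.V // X.graph.Adj p.1 p.2 }

/-- Initial vertex `∂₀ e` of an oriented edge. -/
def d0 {X : GTree G} (e : X.Edge) : X.V := e.1.1

/-- Terminal vertex `∂₁ e` of an oriented edge. -/
def d1 {X : GTree G} (e : X.Edge) : X.V := e.1.2

/-- The underlying geometric (unoriented) edge. -/
def esym {X : GTree G} (e : X.Edge) : Sym2 X.V := s(e.1.1, e.1.2)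

/-- Action of `G` on oriented edges. -/
def edgeSmul {X : GTree G} (γ : G) (e : X.Edge) : X.Edge :=
  ⟨(X.smul γ e.1.1, X.smul γ e.1.2), X.smul_adj γ e.2⟩

/-- Vertex stabilizer `G_x`. -/
def stab (X : GTree G) (x : X.V) : Subgroup G where
  carrier := { γ | X.smul γ x = x }
  one_mem' := X.smul_one x
  mul_mem' := by
    intro a b ha hb
    simp only [Set.mem_setOf_eq] at *
    rw [X.smul_mul, hb, ha]
  inv_mem' := by
    intro a ha
    simp only [Set.mem_setOf_eq] at *
    conv_lhs => rw [← ha]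
    rw [← X.smul_mul, inv_mul_cancel, X.smul_one]

/-- Edge stabilizer `G_e`: the elements fixing both endpoints (since the action
is without inversions, these are exactly the elements fixing the edge). -/
def edgeStab (X : GTree G) (e : X.Edge) : Subgroup G :=
  X.stab (d0 e) ⊓ X.stab (d1 e)

/-- An element of `G` is elliptic if it fixes a vertex. -/
def Elliptic (X : GTree G) (γ : G) : Prop := ∃ x, X.smul γ x = x

/-- A subgroup of `G` is elliptic if it fixes a vertex. -/
def FixesVertex (X : GTree G) (H : Subgroup G) : Prop := ∃ x, ∀ γ ∈ H, X.smul γ x = x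

/-- Two `G`-trees have the same elliptic subgroups. -/
def SameEllipticSubgroups (X Y : GTree G) : Prop :=
  ∀ H : Subgroup G, X.FixesVertex H ↔ Y.FixesVertex H

/-- The length function `ℓ_X(γ)`: the minimal vertex displacement. -/
noncomputable def transLen (X : GTree G) (γ : G) : ℕ :=
  sInf (Set.range fun x => X.graph.dist x (X.smul γ x))

/-- Cocompact: the quotient graph `G\X` is finite, i.e. there are finitely
many orbits of vertices and of edges. -/
def Cocompact (X : GTree G) : Prop :=
  Finite (Quot fun x y : X.V => ∃ γ, X.smul γ x = y) ∧
    Finite (Quot fun e f : X.Edge => ∃ γ, edgeSmul γ e = f)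

/-- Reduced: whenever `G_e = G_{∂₀ e}`, the endpoints of `e` are in the same
`G`-orbit. -/
def Reduced (X : GTree G) : Prop :=
  ∀ e : X.Edge, X.edgeStab e = X.stab (d0 e) → ∃ γ, X.smul γ (d0 e) = d1 e

/-- A nonempty `G`-invariant subtree (a nonempty invariant set of vertices that
is connected in the induced graph). -/
def IsInvariantSubtree (X : GTree G) (S : Set X.V) : Prop :=
  S.Nonempty ∧ (∀ γ, ∀ x ∈ S, X.smul γ x ∈ S) ∧
    ∀ x ∈ S, ∀ y ∈ S, ∃ p : X.graph.Walk x y, ∀ v ∈ p.support, v ∈ S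

/-- Minimal: there is no proper nonempty invariant subtree. -/
def Minimal (X : GTree G) : Prop :=
  ∀ S : Set X.V, X.IsInvariantSubtree S → S = Set.univ

/-- Strongly slide-free: minimal, and for all edges `e`, `f` with
`∂₀ e = ∂₀ f`, the inclusion `G_e ⊆ G_f` implies `f ∈ G e`. -/
def StronglySlideFree (X : GTree G) : Prop :=
  X.Minimal ∧ ∀ e f : X.Edge, d0 e = d0 f → X.edgeStab e ≤ X.edgeStab f →
    ∃ γ, edgeSmul γ e = f

/-- Proper: `G_e ⊊ G_{∂₀ e}` for every edge `e`. -/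
def Proper (X : GTree G) : Prop := ∀ e : X.Edge, X.edgeStab e < X.stab (d0 e)

/-- Locally finite: every vertex has finite valence. -/
def LocallyFinite (X : GTree G) : Prop := ∀ x : X.V, (X.graph.neighborSet x).Finite

/-- `φ` is an isomorphism of `G`-trees: an equivariant graph isomorphism. -/
def IsGIso (X Y : GTree G) (φ : X.V → Y.V) : Prop :=
  Function.Bijective φ ∧ (∀ x y, X.graph.Adj x y ↔ Y.graph.Adj (φ x) (φ y)) ∧
    ∀ γ x, φ (X.smul γ x) = Y.smul γ (φ x)

/-- `φ : X → Y` is the collapse move performed at (the orbit of) the edge `e`: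
`G_e = G_{∂₀ e}`, the endpoints of `e` lie in different `G`-orbits, and `Y` is
the equivariant quotient of `X` identifying `∂₀(γ e)` with `∂₁(γ e)` for all
`γ ∈ G`. -/
def IsCollapse (X Y : GTree G) (φ : X.V → Y.V) (e : X.Edge) : Prop :=
  X.edgeStab e = X.stab (d0 e) ∧
  (∀ γ : G, X.smul γ (d0 e) ≠ d1 e) ∧
  Function.Surjective φ ∧
  (∀ γ x, φ (X.smul γ x) = Y.smul γ (φ x)) ∧
  (∀ u v : X.V, φ u = φ v ↔
    Relation.EqvGen (fun a b => ∃ γ : G, a = X.smul γ (d0 e) ∧ b = X.smul γ (d1 e)) u v) ∧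
  (∀ a b : Y.V, a ≠ b → (Y.graph.Adj a b ↔ ∃ u v, X.graph.Adj u v ∧ φ u = a ∧ φ v = b))

/-- `Y` is obtained from `X` by a collapse move. -/
def Collapse (X Y : GTree G) : Prop := ∃ (φ : X.V → Y.V) (e : X.Edge), IsCollapse X Y φ e

/-- Elementary deformation: a finite composition of collapse moves and their
inverses (expansion moves). -/
def ElemDeformation : GTree G → GTree G → Prop := Relation.EqvGen Collapse

end GTree

namespace SimpleGraph

variable {V : Type*} {T : SimpleGraph V} {a b c d p u v z : V}

/-- The side of `a` once the edge `ab` of `T` is removed. -/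
def Side (T : SimpleGraph V) (a b u : V) : Prop := (T.deleteEdges {s(a, b)}).Reachable u a

theorem Reachable.exists_adj_of_not {H : SimpleGraph V} {P : V → Prop} (h : H.Reachable u v)
    (hu : P u) (hv : ¬P v) : ∃ c d, H.Reachable u c ∧ H.Adj c d ∧ P c ∧ ¬P d := by
  obtain ⟨w⟩ := h
  induction w with
  | nil => exact absurd hu hv
  | @cons x y z hxy w ih =>
    by_cases hy : P y
    · obtain ⟨c, d, hc, h⟩ := ih hy hv
      exact ⟨c, d, hxy.reachable.trans hc, h⟩
    · exact ⟨x, y, .refl x, hxy, hu, hy⟩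

theorem Side.self : T.Side a b a := .refl a

theorem IsTree.not_side (hT : T.IsTree) (hab : T.Adj a b) : ¬T.Side a b b := fun h =>
  (isBridge_iff.1 (isAcyclic_iff_forall_adj_isBridge.1 hT.isAcyclic hab)) (Reachable.symm h)

theorem IsTree.side_cross (hT : T.IsTree) (hab : T.Adj a b) (huv : T.Adj u v)
    (hu : T.Side a b u) (hv : ¬T.Side a b v) : u = a ∧ v = b := by
  by_cases h : s(u, v) = s(a, b)
  · rcases Sym2.eq_iff.1 h with h | ⟨rfl, rfl⟩
    · exact h
    · exact absurd hu (hT.not_side hab)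
  · have : (T.deleteEdges {s(a, b)}).Adj v u := by
      rw [deleteEdges_adj]
      exact ⟨huv.symm, by rwa [Sym2.eq_swap (a := v)]⟩
    exact absurd (this.reachable.trans hu) hv

theorem IsTree.not_side_iff (hT : T.IsTree) (hab : T.Adj a b) :
    ¬T.Side a b u ↔ T.Side b a u := by
  constructor
  · intro hu
    by_contra hu'
    obtain ⟨c, d, -, hcd, hc, hd⟩ := (hT.connected.preconnected a u).exists_adj_of_not
      (P := fun w => T.Side a b w ∨ T.Side b a w) (.inl .self) (by tauto)
    simp only [not_or] at hd
    rcases hc with hc | hc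
    · exact hd.2 ((hT.side_cross hab hcd hc hd.1).2 ▸ .self)
    · exact hd.1 ((hT.side_cross hab.symm hcd hc hd.2).2 ▸ .self)
  · intro h hba
    rw [Side, Sym2.eq_swap] at h
    exact hT.not_side hab (h.symm.trans hba)

/-- A set of vertices whose only boundary edge is `ab` is a half-tree. -/
theorem IsTree.side_iff_of_cross (hT : T.IsTree) (hab : T.Adj a b) {P : V → Prop} (ha : P a)
    (hb : ¬P b) (hP : ∀ u v, T.Adj u v → P u → ¬P v → u = a ∧ v = b) (u : V) :
    P u ↔ T.Side a b u := by
  have key : ∀ {c d}, (T.deleteEdges {s(a, b)}).Reachable c d → P c → P d := by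
    intro c d h hc
    by_contra hd
    obtain ⟨x, y, -, hxy, hx, hy⟩ := h.exists_adj_of_not hc hd
    rw [deleteEdges_adj] at hxy
    obtain ⟨rfl, rfl⟩ := hP x y hxy.1 hx hy
    exact hxy.2 rfl
  refine ⟨fun hu => ?_, fun h => key h.symm ha⟩
  by_contra h
  rw [hT.not_side_iff hab, Side, Sym2.eq_swap] at h
  exact hb (key h hu)

/-- Half-trees are convex. -/
theorem IsTree.side_convex (hT : T.IsTree) (hcd : T.Adj c d) (hu : T.Side a b u)
    (hv : T.Side a b v) (hu' : T.Side c d u) (hv' : ¬T.Side c d v) :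
    T.Side a b c ∧ T.Side a b d := by
  obtain ⟨x, y, hx, hxy, hcx, hcy⟩ := (Reachable.trans hu hv.symm).exists_adj_of_not hu' hv'
  obtain ⟨rfl, rfl⟩ := hT.side_cross hcd (deleteEdges_le _ hxy) hcx hcy
  have h := hx.symm.trans hu
  exact ⟨h, hxy.symm.reachable.trans h⟩

theorem IsTree.exists_side (hT : T.IsTree) (h : u ≠ v) : ∃ p, T.Adj p v ∧ T.Side p v u := by
  by_contra hu
  obtain ⟨c, d, -, hcd, hc, hd⟩ := (hT.connected.preconnected v u).exists_adj_of_not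
    (P := fun w => w = v ∨ ∃ p, T.Adj p v ∧ T.Side p v w) (.inl rfl) (not_or.2 ⟨h, hu⟩)
  simp only [not_or] at hd
  rcases hc with rfl | ⟨p, hp, hc⟩
  · exact hd.2 ⟨d, hcd.symm, .self⟩
  · by_cases h : T.Side p v d
    · exact hd.2 ⟨p, hp, h⟩
    · exact hd.1 (hT.side_cross hp hcd hc h).2

theorem IsTree.dist_lt_of_side (hT : T.IsTree) (hab : T.Adj a b) (hu : T.Side a b u)
    (hz : ¬T.Side a b z) : T.dist u a < T.dist u z := by
  obtain ⟨w, hw⟩ := hT.connected.exists_walk_length_eq_dist u z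
  rw [← hw]
  clear hw
  induction w with
  | nil => exact absurd hu hz
  | @cons x y z hxy w ih =>
    rw [Walk.length_cons]
    by_cases hy : T.Side a b y
    · have h1 := ih hy hz
      have h2 := hT.connected.dist_triangle (u := x) (v := y) (w := a)
      rw [dist_eq_one_iff_adj.2 hxy] at h2
      omega
    · rw [(hT.side_cross hab hxy hu hy).1, dist_self]
      omega

/-- Two edges separating `u` from `v` in the same direction coincide as soon as they are at the
same distance from `u`. -/
theorem IsTree.eq_of_side_of_dist_eq (hT : T.IsTree) (hab : T.Adj a b) (hcd : T.Adj c d)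
    (hu : T.Side a b u) (hv : ¬T.Side a b v) (hu' : T.Side c d u) (hv' : ¬T.Side c d v)
    (h : T.dist u a = T.dist u c) : a = c ∧ b = d := by
  have hac : T.Side a b c := by
    by_contra hc
    have := hT.dist_lt_of_side hab hu hc
    omega
  have hca : T.Side c d a := by
    by_contra ha
    have := hT.dist_lt_of_side hcd hu' ha
    omega
  by_cases hbd : T.Side a b d
  · by_cases hdb : T.Side c d b
    · rw [hT.not_side_iff hab] at hv
      have := (hT.side_convex hcd (Side.self (T := T)) hv hdb hv').1
      exact absurd hac ((hT.not_side_iff hab).2 this)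
    · exact hT.side_cross hcd hab hca hdb
  · exact (hT.side_cross hab hcd hac hbd).imp Eq.symm Eq.symm

theorem IsTree.side_of_side (hT : T.IsTree) (hpa : T.Adj p a) (hab : T.Adj a b) (hpb : p ≠ b)
    (hz : T.Side p a z) : T.Side a b z := by
  by_contra h
  have hp : T.Side a b p := by
    by_contra hp
    exact hpb (hT.side_cross hab hpa.symm .self hp).2
  exact hT.not_side hpa (hT.side_convex hab .self hz hp h).1

end SimpleGraph

namespace GTree

variable {G : Type u} [Group G] {X Y : GTree G}

theorem inv_smul_smul (X : GTree G) (γ : G) (x : X.V) : X.smul γ⁻¹ (X.smul γ x) = x := by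
  rw [← X.smul_mul, inv_mul_cancel, X.smul_one]

theorem smul_inv_smul (X : GTree G) (γ : G) (x : X.V) : X.smul γ (X.smul γ⁻¹ x) = x := by
  rw [← X.smul_mul, mul_inv_cancel, X.smul_one]

theorem inv_smul_eq {γ : G} {x y : X.V} (h : X.smul γ x = y) : X.smul γ⁻¹ y = x := by
  rw [← h, inv_smul_smul]

theorem smul_injective (X : GTree G) (γ : G) : Function.Injective (X.smul γ) :=
  Function.LeftInverse.injective (X.inv_smul_smul γ)

theorem adj_smul_iff {γ : G} {x y : X.V} :
    X.graph.Adj (X.smul γ x) (X.smul γ y) ↔ X.graph.Adj x y := by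
  refine ⟨fun h => ?_, fun h => X.smul_adj γ h⟩
  simpa only [inv_smul_smul] using X.smul_adj γ⁻¹ h

theorem dist_smul (X : GTree G) (γ : G) (x y : X.V) :
    X.graph.dist (X.smul γ x) (X.smul γ y) = X.graph.dist x y := by
  have key : ∀ (γ : G) (x y : X.V),
      X.graph.dist (X.smul γ x) (X.smul γ y) ≤ X.graph.dist x y := by
    intro γ x y
    obtain ⟨w, hw⟩ := X.isTree.connected.exists_walk_length_eq_dist x y
    let f : X.graph →g X.graph := ⟨X.smul γ, fun h => X.smul_adj γ h⟩
    rw [← hw, ← w.length_map f]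
    exact SimpleGraph.dist_le _
  refine le_antisymm (key γ x y) ?_
  simpa only [inv_smul_smul] using key γ⁻¹ (X.smul γ x) (X.smul γ y)

theorem side_smul {γ : G} {a b u : X.V} (hab : X.graph.Adj a b) :
    X.graph.Side (X.smul γ a) (X.smul γ b) (X.smul γ u) ↔ X.graph.Side a b u := by
  have hγ := X.smul_adj γ hab
  refine X.isTree.side_iff_of_cross hab
    (P := fun u => X.graph.Side (X.smul γ a) (X.smul γ b) (X.smul γ u)) .self
    (X.isTree.not_side hγ) (fun u v huv hu hv => ?_) u
  exact (X.isTree.side_cross hγ (X.smul_adj γ huv) hu hv).imp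
    (fun h => X.smul_injective γ h) (fun h => X.smul_injective γ h)

theorem side_inv_smul {γ : G} {a b u : X.V} (hab : X.graph.Adj a b) :
    X.graph.Side a b (X.smul γ⁻¹ u) ↔ X.graph.Side (X.smul γ a) (X.smul γ b) u := by
  rw [← side_smul (γ := γ) hab, smul_inv_smul]

/-- An element fixing two points fixes every edge separating them. -/
theorem fixes_of_separates {γ : G} {a b u v : X.V} (hab : X.graph.Adj a b)
    (hu : X.graph.Side a b u) (hv : ¬X.graph.Side a b v) (hγu : X.smul γ u = u)
    (hγv : X.smul γ v = v) : X.smul γ a = a ∧ X.smul γ b = b := by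
  have h := X.isTree.eq_of_side_of_dist_eq hab (X.smul_adj γ hab) hu hv
    (by rwa [← hγu, side_smul hab]) (by rwa [← hγv, side_smul hab])
    (by rw [← X.dist_smul γ u a, hγu])
  exact ⟨h.1.symm, h.2.symm⟩

/-- The oriented edge given by a pair of adjacent vertices. -/
def mkEdge {x y : X.V} (h : X.graph.Adj x y) : X.Edge := ⟨(x, y), h⟩

theorem Reduced.exists_smul_eq (hX : X.Reduced) {x y : X.V} (h : X.graph.Adj x y)
    (hs : X.stab x ≤ X.stab y) : ∃ γ, X.smul γ x = y :=
  hX (mkEdge h) (inf_eq_left.2 hs)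

theorem StronglySlideFree.exists_smul_eq (hX : X.StronglySlideFree) {x y z : X.V}
    (hy : X.graph.Adj x y) (hz : X.graph.Adj x z)
    (hs : X.stab x ⊓ X.stab y ≤ X.stab z) : ∃ γ, X.smul γ x = x ∧ X.smul γ y = z := by
  obtain ⟨γ, hγ⟩ := hX.2 (mkEdge hy) (mkEdge hz) rfl (le_inf inf_le_left hs)
  have := congrArg Subtype.val hγ
  exact ⟨γ, congrArg Prod.fst this, congrArg Prod.snd this⟩

/-- A minimal tree has no vertex of valence one. -/
theorem Minimal.not_unique_neighbor (hX : X.Minimal) {x y : X.V} (hxy : X.graph.Adj x y)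
    (hx : ∀ z, X.graph.Adj x z → z = y) : False := by
  have hnb : ∀ γ z, X.graph.Adj (X.smul γ x) z → z = X.smul γ y := by
    intro γ z h
    rw [← X.smul_inv_smul γ z, adj_smul_iff] at h
    rw [← hx _ h, smul_inv_smul]
  have hy : ∀ γ, X.smul γ x ≠ y := by
    intro γ hγ
    have := hnb γ x (hγ ▸ hxy.symm)
    exact X.no_inversions γ x y hxy ⟨hγ, this.symm⟩
  have hS : X.IsInvariantSubtree {z | ∀ γ, X.smul γ x ≠ z} := by
    refine ⟨⟨y, hy⟩, fun γ z hz δ h => hz (γ⁻¹ * δ) ?_, ?_⟩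
    · rw [X.smul_mul, h, inv_smul_smul]
    · have key : ∀ (n : ℕ) (u v : X.V) (w : X.graph.Walk u v), w.length ≤ n →
          (∀ γ, X.smul γ x ≠ u) → (∀ γ, X.smul γ x ≠ v) →
          ∃ p : X.graph.Walk u v, ∀ z ∈ p.support, ∀ γ, X.smul γ x ≠ z := by
        intro n
        induction n with
        | zero =>
          intro u v w hw hu hv
          cases w with
          | nil => exact ⟨.nil, by simpa using hu⟩
          | cons => simp at hw
        | succ n ih =>
          intro u v w hw hu hv
          cases w with
          | nil => exact ⟨.nil, by simpa using hu⟩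
          | @cons _ u' _ h w =>
            simp only [SimpleGraph.Walk.length_cons] at hw
            by_cases hu' : ∀ γ, X.smul γ x ≠ u'
            · obtain ⟨p, hp⟩ := ih u' v w (by omega) hu' hv
              refine ⟨.cons h p, ?_⟩
              simp only [SimpleGraph.Walk.support_cons, List.mem_cons]
              rintro z (rfl | hz)
              · exact hu
              · exact hp z hz
            · push Not at hu'
              obtain ⟨γ, rfl⟩ := hu'
              cases w with
              | nil => exact absurd rfl (hv γ)
              | @cons _ u'' _ h' w =>
                obtain rfl : u = u'' := (hnb γ u h.symm).trans (hnb γ u'' h').symm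
                simp only [SimpleGraph.Walk.length_cons] at hw
                exact ih u v w (by omega) hu hv
      intro u hu v hv
      obtain ⟨w⟩ := X.isTree.connected.preconnected u v
      exact key _ u v w le_rfl hu hv
  have : x ∈ {z | ∀ γ, X.smul γ x ≠ z} := hX _ hS ▸ Set.mem_univ x
  exact this 1 (X.smul_one x)

/-- A strongly slide-free tree is proper. -/
theorem StronglySlideFree.not_stab_le (hX : X.StronglySlideFree) {x y : X.V}
    (hxy : X.graph.Adj x y) : ¬X.stab x ≤ X.stab y := by
  intro h
  refine hX.1.not_unique_neighbor hxy fun z hz => ?_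
  obtain ⟨γ, hγx, hγz⟩ := hX.exists_smul_eq hz hxy (inf_le_left.trans h)
  exact X.smul_injective γ (hγz.trans (h hγx : X.smul γ y = y).symm)

/-- The edges `xy` of `X` and `ab` of `Y` induce the same partition of the vertices of `X`. -/
def Matches {X Y : GTree G} (h : X.V → Y.V) (x y : X.V) (a b : Y.V) : Prop :=
  ∀ v, X.graph.Side x y v ↔ Y.graph.Side a b (h v)

/-- Every edge of `X` is matched by an edge of `Y`. -/
def IsSeparating (X Y : GTree G) (h : X.V → Y.V) : Prop :=
  (∀ γ x, h (X.smul γ x) = Y.smul γ (h x)) ∧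
    ∀ x y, X.graph.Adj x y → ∃ a b, Y.graph.Adj a b ∧ Matches h x y a b

theorem isSeparating_id (X : GTree G) : IsSeparating X X id :=
  ⟨fun _ _ => rfl, fun x y hxy => ⟨x, y, hxy, fun _ => Iff.rfl⟩⟩

namespace IsCollapse

variable {φ : X.V → Y.V} {e : X.Edge}

theorem adj (h : IsCollapse X Y φ e) {a b : X.V} (hab : X.graph.Adj a b) (hne : φ a ≠ φ b) :
    Y.graph.Adj (φ a) (φ b) :=
  (h.2.2.2.2.2 _ _ hne).2 ⟨a, b, hab, rfl, rfl⟩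

theorem map_smul_d0 (h : IsCollapse X Y φ e) (γ : G) :
    φ (X.smul γ (d0 e)) = φ (X.smul γ (d1 e)) :=
  (h.2.2.2.2.1 _ _).2 (.rel _ _ ⟨γ, rfl, rfl⟩)

/-- A set of vertices not separated by collapsed edges descends to the quotient. -/
theorem iff_of_map_eq (h : IsCollapse X Y φ e) {P : X.V → Prop}
    (hP : ∀ γ, P (X.smul γ (d0 e)) ↔ P (X.smul γ (d1 e))) {u v : X.V} (huv : φ u = φ v) :
    P u ↔ P v := by
  have := (h.2.2.2.2.1 u v).1 huv
  induction this with
  | rel x y hxy => obtain ⟨γ, rfl, rfl⟩ := hxy; exact hP γ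
  | refl => rfl
  | symm x y h1 ih => exact (ih ((h.2.2.2.2.1 _ _).2 h1)).symm
  | trans x y z h1 h2 ih1 ih2 =>
    exact (ih1 ((h.2.2.2.2.1 _ _).2 h1)).trans (ih2 ((h.2.2.2.2.1 _ _).2 h2))

/-- Collapsed edges do not cross the half-tree of any other edge. -/
theorem side_smul_d0_iff {a b : X.V} (hab : X.graph.Adj a b)
    (h₁ : ∀ γ, a = X.smul γ (d0 e) → b ≠ X.smul γ (d1 e))
    (h₂ : ∀ γ, b = X.smul γ (d0 e) → a ≠ X.smul γ (d1 e)) (γ : G) :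
    X.graph.Side a b (X.smul γ (d0 e)) ↔ X.graph.Side a b (X.smul γ (d1 e)) := by
  have hadj := X.smul_adj γ e.2
  constructor
  · intro h0
    by_contra h1
    obtain ⟨h2, h3⟩ := X.isTree.side_cross hab hadj h0 h1
    exact h₁ γ h2.symm h3.symm
  · intro h1
    by_contra h0
    obtain ⟨h2, h3⟩ := X.isTree.side_cross hab hadj.symm h1 h0
    exact h₂ γ h3.symm h2.symm

/-- The edges with trivial image are the translates of `e`. -/
theorem eq_smul_of_map_eq (h : IsCollapse X Y φ e) {a b : X.V} (hab : X.graph.Adj a b)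
    (hφ : φ a = φ b) : (∃ γ, a = X.smul γ (d0 e) ∧ b = X.smul γ (d1 e)) ∨
      ∃ γ, b = X.smul γ (d0 e) ∧ a = X.smul γ (d1 e) := by
  by_contra hcon
  push Not at hcon
  exact X.isTree.not_side hab
    ((h.iff_of_map_eq (side_smul_d0_iff hab hcon.1 hcon.2) hφ).1 .self)

theorem side_iff (h : IsCollapse X Y φ e) {a b : X.V} (hab : X.graph.Adj a b)
    (hne : φ a ≠ φ b) (u : X.V) :
    X.graph.Side a b u ↔ Y.graph.Side (φ a) (φ b) (φ u) := by
  have hconst : ∀ {u v}, φ u = φ v → (X.graph.Side a b u ↔ X.graph.Side a b v) :=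
    h.iff_of_map_eq (side_smul_d0_iff hab
      (fun γ ha hb => hne (by rw [ha, hb, h.map_smul_d0]))
      (fun γ hb ha => hne (by rw [ha, hb, h.map_smul_d0])))
  have hP : ∀ v, (∃ u, φ u = φ v ∧ X.graph.Side a b u) ↔ X.graph.Side a b v := fun v =>
    ⟨fun ⟨_, h1, h2⟩ => (hconst h1).1 h2, fun h1 => ⟨v, rfl, h1⟩⟩
  rw [← hP]
  refine Y.isTree.side_iff_of_cross (h.adj hab hne)
    (P := fun y => ∃ u, φ u = y ∧ X.graph.Side a b u) ((hP a).2 .self)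
    (fun hb => X.isTree.not_side hab ((hP b).1 hb)) ?_ (φ u)
  intro y z hyz hy hz
  obtain ⟨u, v, huv, rfl, rfl⟩ := (h.2.2.2.2.2 _ _ hyz.ne).1 hyz
  rw [hP] at hy hz
  obtain ⟨rfl, rfl⟩ := X.isTree.side_cross hab huv hy hz
  exact ⟨rfl, rfl⟩

theorem smul_d0_ne (h : IsCollapse X Y φ e) (γ δ : G) :
    X.smul δ (d0 e) ≠ X.smul γ (d1 e) := by
  intro hγ
  apply h.2.1 (γ⁻¹ * δ)
  rw [X.smul_mul, hγ, inv_smul_smul]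

theorem smul_d1_eq (h : IsCollapse X Y φ e) {γ δ : G} (hγ : X.smul γ (d0 e) = X.smul δ (d0 e)) :
    X.smul γ (d1 e) = X.smul δ (d1 e) := by
  have h0 : X.smul (δ⁻¹ * γ) (d0 e) = d0 e := by rw [X.smul_mul, hγ, inv_smul_smul]
  have h1 : X.smul (δ⁻¹ * γ) (d1 e) = d1 e := (inf_eq_left.1 h.1 : _ ≤ X.stab (d1 e)) h0
  rw [← X.smul_inv_smul δ (X.smul γ (d1 e)), ← X.smul_mul δ⁻¹ γ, h1]

/-- Each fibre of a collapse contains exactly one vertex outside the orbit of `d0 e`. -/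
theorem existsUnique_center (h : IsCollapse X Y φ e) (y : Y.V) :
    ∃! u, φ u = y ∧ ∀ γ, X.smul γ (d0 e) ≠ u := by
  obtain ⟨u, rfl⟩ := h.2.2.1 y
  have hex : ∃ v, φ v = φ u ∧ ∀ γ, X.smul γ (d0 e) ≠ v := by
    by_cases hu : ∀ γ, X.smul γ (d0 e) ≠ u
    · exact ⟨u, rfl, hu⟩
    · push Not at hu
      obtain ⟨γ, rfl⟩ := hu
      exact ⟨X.smul γ (d1 e), (h.map_smul_d0 γ).symm, h.smul_d0_ne γ⟩
  obtain ⟨v, hv, hv'⟩ := hex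
  refine ⟨v, ⟨hv, hv'⟩, fun w ⟨hw, hw'⟩ => ?_⟩
  have := h.iff_of_map_eq (P := fun z => z = v ∨ ∃ γ, z = X.smul γ (d0 e) ∧ v = X.smul γ (d1 e))
    (fun γ => ?_) (hw.trans hv.symm)
  · rcases this.2 (.inl rfl) with rfl | ⟨γ, rfl, -⟩
    · rfl
    · exact absurd rfl (hw' γ)
  · constructor
    · rintro (rfl | ⟨δ, hδ, rfl⟩)
      · exact absurd rfl (hv' γ)
      · exact .inl (h.smul_d1_eq hδ)
    · rintro (rfl | ⟨δ, hδ, rfl⟩)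
      · exact .inr ⟨γ, rfl, rfl⟩
      · exact absurd hδ.symm (h.smul_d0_ne γ δ)

/-- A collapse admits an equivariant section. -/
theorem exists_section (h : IsCollapse X Y φ e) :
    ∃ c : Y.V → X.V, (∀ y, φ (c y) = y) ∧ ∀ γ y, c (Y.smul γ y) = X.smul γ (c y) := by
  choose c hc hc' using h.existsUnique_center
  refine ⟨c, fun y => (hc y).1, fun γ y => (hc' _ _ ⟨?_, ?_⟩).symm⟩
  · rw [h.2.2.2.1, (hc y).1]
  · intro δ hδ
    apply (hc y).2 (γ⁻¹ * δ)
    rw [X.smul_mul, hδ, inv_smul_smul]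

end IsCollapse

/-- Separating maps lift through expansions. -/
theorem IsSeparating.expand {Y' : GTree G} {h : X.V → Y.V} (hh : IsSeparating X Y h)
    (hc : Collapse Y' Y) : ∃ h', IsSeparating X Y' h' := by
  obtain ⟨φ, e, he⟩ := hc
  obtain ⟨c, hc, hcG⟩ := he.exists_section
  refine ⟨c ∘ h, fun γ x => ?_, fun x y hxy => ?_⟩
  · simp only [Function.comp, hh.1, hcG]
  · obtain ⟨a, b, hab, hside⟩ := hh.2 x y hxy
    obtain ⟨a, b, hab', rfl, rfl⟩ := (he.2.2.2.2.2 _ _ hab.ne).1 hab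
    refine ⟨a, b, hab', fun v => ?_⟩
    rw [hside, he.side_iff hab' hab.ne, Function.comp, hc]

section

variable {h : X.V → Y.V} {x y : X.V} {a b : Y.V}

theorem Matches.symm (hm : Matches h x y a b) (hxy : X.graph.Adj x y) (hab : Y.graph.Adj a b) :
    Matches h y x b a := fun v => by
  rw [← X.isTree.not_side_iff hxy, ← Y.isTree.not_side_iff hab, hm v]

theorem Matches.smul (hh : IsSeparating X Y h) (hm : Matches h x y a b) (hxy : X.graph.Adj x y)
    (hab : Y.graph.Adj a b) (γ : G) :
    Matches h (X.smul γ x) (X.smul γ y) (Y.smul γ a) (Y.smul γ b) := fun v => by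
  rw [← side_inv_smul hxy, ← side_inv_smul hab, hm, hh.1]

/-- Matching edges determine each other. -/
theorem Matches.eq {x' y' : X.V} (hm : Matches h x y a b) (hm' : Matches h x' y' a b)
    (hxy : X.graph.Adj x y) (hxy' : X.graph.Adj x' y') : x' = x ∧ y' = y := by
  have key : ∀ v, X.graph.Side x' y' v ↔ X.graph.Side x y v := fun v => (hm' v).trans (hm v).symm
  exact X.isTree.side_cross hxy hxy' ((key _).1 .self)
    fun h => X.isTree.not_side hxy' ((key _).2 h)

theorem Matches.fixes (hh : IsSeparating X Y h) (hm : Matches h x y a b)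
    (hxy : X.graph.Adj x y) (hab : Y.graph.Adj a b) {γ : G} (ha : Y.smul γ a = a)
    (hb : Y.smul γ b = b) : X.smul γ x = x ∧ X.smul γ y = y := by
  have := hm.smul hh hxy hab γ
  rw [ha, hb] at this
  exact hm.eq this hxy (X.smul_adj γ hxy)

/-- If an edge matching `xy` has a terminal vertex group, so that it can be collapsed, then the
edge preceding it on the way from `h x` matches `xy` as well. -/
theorem Matches.exists_previous (hX : X.StronglySlideFree) (hh : IsSeparating X Y h)
    (hm : Matches h x y a b) (hxy : X.graph.Adj x y) (hab : Y.graph.Adj a b)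
    (hs : Y.stab a ≤ Y.stab b) :
    ∃ p, Y.graph.Adj p a ∧ p ≠ b ∧ Matches h x y p a := by
  have hfix : ∀ γ, Y.smul γ a = a → X.smul γ x = x ∧ X.smul γ y = y := fun γ hγ =>
    hm.fixes hh hxy hab hγ (hs hγ)
  have hxa : h x ≠ a := by
    intro hxa
    refine hX.not_stab_le hxy fun γ (hγ : X.smul γ x = x) => (hfix γ ?_).2
    rw [← hxa, ← hh.1, hγ]
  obtain ⟨p, hpa, hpx⟩ := Y.isTree.exists_side hxa
  have hpb : p ≠ b := by
    rintro rfl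
    exact (Y.isTree.not_side_iff hpa.symm).2 hpx ((hm x).1 .self)
  refine ⟨p, hpa, hpb, fun v => ⟨fun hv => ?_, fun hv => (hm v).2 ?_⟩⟩
  swap
  · exact Y.isTree.side_of_side hpa hab hpb hv
  by_contra hpv
  have hvx : v ≠ x := fun hvx => hpv (hvx ▸ hpx)
  obtain ⟨y₁, hy₁x, hy₁v⟩ := X.isTree.exists_side hvx
  have hxy₁ := hy₁x.symm
  have hv₁ : ¬X.graph.Side x y₁ v := (X.isTree.not_side_iff hxy₁).2 hy₁v
  have hyy₁ : y ≠ y₁ := by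
    rintro rfl
    exact hv₁ hv
  have hside : ∀ {c d}, Y.graph.Adj c d → Matches h x y₁ c d → Y.graph.Side c d a := by
    intro c d hcd hm₁
    refine (Y.isTree.side_convex hab ((hm₁ x).1 .self) ((hm₁ y).1 ?_) ((hm x).1 .self)
      fun hy => X.isTree.not_side hxy ((hm y).2 hy)).1
    by_contra hy
    exact hyy₁ (X.isTree.side_cross hxy₁ hxy .self hy).2
  obtain ⟨c, d, hcd, hm₁⟩ := hh.2 x y₁ hxy₁
  have hpy₁ : ¬Y.graph.Side p a (h y₁) := by
    intro hy₁
    have := Y.isTree.side_convex hpa ((hm₁.symm hxy₁ hcd y₁).1 .self)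
      ((hm₁.symm hxy₁ hcd v).1 hy₁v) hy₁ hpv
    exact (Y.isTree.not_side_iff hcd).2 this.2 (hside hcd hm₁)
  obtain ⟨γ, hγx, hγy⟩ := hX.exists_smul_eq hxy₁ hxy fun γ ⟨hγx, hγy⟩ => by
    have hγx : X.smul γ x = x := hγx
    have hγy : X.smul γ y₁ = y₁ := hγy
    exact (hfix γ (fixes_of_separates hpa hpx hpy₁ (by rw [← hh.1, hγx])
      (by rw [← hh.1, hγy])).2).2
  have hγx' := inv_smul_eq hγx
  have hγhx : Y.smul γ⁻¹ (h x) = h x := by rw [← hh.1, hγx']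
  have hm₂ := hm.smul hh hxy hab γ⁻¹
  rw [hγx', inv_smul_eq hγy] at hm₂
  have hpa' := Y.smul_adj γ⁻¹ hpa
  have hab' := Y.smul_adj γ⁻¹ hab
  have hγa := (Y.isTree.eq_of_side_of_dist_eq hpa hpa' hpx hpv
    (by rwa [← hγhx, side_smul hpa])
    (fun hv' => hv₁ ((hm₂ v).2 (Y.isTree.side_of_side hpa' hab'
      (fun h => hpb (Y.smul_injective _ h)) hv')))
    (by rw [← Y.dist_smul γ⁻¹ (h x) p, hγhx])).2
  have := (hfix γ⁻¹ hγa.symm).2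
  exact hyy₁ (this.symm.trans (inv_smul_eq hγy))

theorem IsSeparating.injective (hh : IsSeparating X Y h) : Function.Injective h := by
  intro x y hxy
  by_contra hne
  obtain ⟨p, hp, hpx⟩ := X.isTree.exists_side hne
  obtain ⟨a, b, -, hm⟩ := hh.2 p y hp
  exact X.isTree.not_side hp ((hm y).2 (hxy ▸ (hm x).1 hpx))

end

/-- Separating maps out of strongly slide-free trees descend to collapses. -/
theorem IsSeparating.collapse (hX : X.StronglySlideFree) {Y' : GTree G} {h : X.V → Y.V}
    (hh : IsSeparating X Y h) (hc : Collapse Y Y') : ∃ h', IsSeparating X Y' h' := by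
  obtain ⟨φ, e, he⟩ := hc
  refine ⟨φ ∘ h, fun γ x => ?_, fun x y hxy => ?_⟩
  · simp only [Function.comp, hh.1, he.2.2.2.1]
  suffices ∃ a b, Y.graph.Adj a b ∧ φ a ≠ φ b ∧ Matches h x y a b by
    obtain ⟨a, b, hab, hne, hm⟩ := this
    exact ⟨φ a, φ b, he.adj hab hne, fun v => (hm v).trans (he.side_iff hab hne _)⟩
  have key : ∀ {x y γ}, X.graph.Adj x y →
      Matches h x y (Y.smul γ (d0 e)) (Y.smul γ (d1 e)) →
      ∃ a b, Y.graph.Adj a b ∧ φ a ≠ φ b ∧ Matches h x y a b := by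
    intro x y γ hxy hm
    have hle : Y.stab (Y.smul γ (d0 e)) ≤ Y.stab (Y.smul γ (d1 e)) := by
      intro δ (hδ : Y.smul δ (Y.smul γ (d0 e)) = Y.smul γ (d0 e))
      rw [← Y.smul_mul] at hδ
      exact (Y.smul_mul δ γ _).symm.trans (he.smul_d1_eq hδ)
    obtain ⟨p, hp, hpb, hm'⟩ := hm.exists_previous hX hh hxy (Y.smul_adj γ e.2) hle
    refine ⟨p, _, hp, fun hφ => ?_, hm'⟩
    rcases he.eq_smul_of_map_eq hp hφ with ⟨δ, -, hδ⟩ | ⟨δ, hδ, rfl⟩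
    · exact he.smul_d0_ne _ _ hδ
    · exact hpb (he.smul_d1_eq hδ.symm)
  obtain ⟨a, b, hab, hm⟩ := hh.2 x y hxy
  by_cases hφ : φ a = φ b
  · rcases he.eq_smul_of_map_eq hab hφ with ⟨γ, rfl, rfl⟩ | ⟨γ, rfl, rfl⟩
    · exact key hxy hm
    · obtain ⟨a, b, hab', hne, hm'⟩ := key hxy.symm (hm.symm hxy hab)
      exact ⟨b, a, hab'.symm, hne.symm, hm'.symm hxy.symm hab'⟩
  · exact ⟨a, b, hab, hφ, hm⟩

theorem ElemDeformation.exists_isSeparating (hX : X.StronglySlideFree)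
    (hd : ElemDeformation X Y) : ∃ h, IsSeparating X Y h := by
  have key : ∀ {A B : GTree G}, ElemDeformation A B →
      ((∃ h, IsSeparating X A h) ↔ ∃ h, IsSeparating X B h) := by
    intro A B hAB
    induction hAB with
    | rel A B h => exact ⟨fun ⟨_, hh⟩ => hh.collapse hX h, fun ⟨_, hh⟩ => hh.expand h⟩
    | refl => rfl
    | symm A B _ ih => exact ih.symm
    | trans A B C _ _ ih1 ih2 => exact ih1.trans ih2
  exact (key hd).1 ⟨id, isSeparating_id X⟩

section

variable {h : X.V → Y.V}

/-- In a reduced tree, every edge at a vertex `h x` matches an edge at `x`. -/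
theorem IsSeparating.exists_matches (hh : IsSeparating X Y h) (hY : Y.Reduced) {x : X.V} {u : Y.V}
    (hu : Y.graph.Adj (h x) u) : ∃ y, X.graph.Adj x y ∧ Matches h x y (h x) u := by
  by_contra hcon
  push Not at hcon
  have hQ : ∀ {y a b}, X.graph.Adj x y → Y.graph.Adj a b → Matches h x y a b →
      Y.graph.Side a b u := by
    intro y a b hxy hab hm
    by_contra hub
    obtain ⟨rfl, rfl⟩ := Y.isTree.side_cross hab hu ((hm x).1 .self) hub
    exact hcon y hxy hm
  have hle : Y.stab u ≤ Y.stab (h x) := by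
    intro γ (hγ : Y.smul γ u = u)
    change Y.smul γ (h x) = h x
    rw [← hh.1]
    by_contra hne
    have hne : X.smul γ x ≠ x := fun h => hne (by rw [h])
    obtain ⟨y, hyx, hy⟩ := X.isTree.exists_side hne
    obtain ⟨a, b, hab, hm⟩ := hh.2 x y hyx.symm
    have hua := hQ hyx.symm hab hm
    have hQ' : ∀ {y c d}, X.graph.Adj (X.smul γ x) y → Y.graph.Adj c d →
        Matches h (X.smul γ x) y c d → Y.graph.Side c d u := by
      intro y c d hxy hcd hm
      have hm' := hm.smul hh hxy hcd γ⁻¹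
      have hxy' := X.smul_adj γ⁻¹ hxy
      rw [inv_smul_smul] at hm' hxy'
      have := hQ hxy' (Y.smul_adj γ⁻¹ hcd) hm'
      rwa [← inv_smul_eq hγ, side_smul hcd] at this
    by_cases hyγ : y = X.smul γ x
    · subst hyγ
      exact (Y.isTree.not_side_iff hab.symm).2 hua (hQ' hyx hab.symm (hm.symm hyx.symm hab))
    obtain ⟨y', hyx', hy'⟩ := X.isTree.exists_side (Ne.symm hne)
    obtain ⟨c, d, hcd, hm'⟩ := hh.2 _ y' hyx'.symm
    have hx' := (X.isTree.not_side_iff hyx'.symm).2 hy'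
    have hac := Y.isTree.side_convex hcd hua ((hm x).1 .self) (hQ' hyx'.symm hcd hm')
      fun hx => hx' ((hm' x).2 hx)
    have hbc := Y.isTree.side_convex hcd ((hm.symm hyx.symm hab _).1 hy)
      ((hm.symm hyx.symm hab y).1 .self) ((hm' _).1 .self) fun hy =>
        hyγ (X.isTree.side_cross hyx'.symm hyx ((hm' y).2 hy) hx').1
    exact (Y.isTree.not_side_iff hab).2 hbc.1 hac.1
  obtain ⟨γ, hγ⟩ := hY.exists_smul_eq hu.symm hle
  have hux : u = h (X.smul γ⁻¹ x) := by rw [hh.1, inv_smul_eq hγ]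
  obtain ⟨y, hyx, hy⟩ := X.isTree.exists_side (u := X.smul γ⁻¹ x) (v := x)
    fun hx => hu.ne (by rw [hux, hx])
  obtain ⟨a, b, hab, hm⟩ := hh.2 x y hyx.symm
  exact (X.isTree.not_side_iff hyx.symm).2 hy ((hm _).2 (hux ▸ hQ hyx.symm hab hm))

theorem IsSeparating.adj (hh : IsSeparating X Y h) (hY : Y.Reduced) {x y : X.V}
    (hxy : X.graph.Adj x y) : Y.graph.Adj (h x) (h y) := by
  have key : ∀ {x y}, X.graph.Adj x y → ∃ u, Y.graph.Adj (h x) u ∧ Matches h x y (h x) u := by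
    intro x y hxy
    obtain ⟨u, hu, huy⟩ := Y.isTree.exists_side (hh.injective.ne hxy.ne.symm)
    obtain ⟨y', hxy', hm⟩ := hh.exists_matches hY hu.symm
    obtain rfl := (X.isTree.side_cross hxy' hxy .self
      fun hy => (Y.isTree.not_side_iff hu.symm).2 huy ((hm y).1 hy)).2
    exact ⟨u, hu.symm, hm⟩
  obtain ⟨u, hu, hm⟩ := key hxy
  obtain ⟨v, hv, hm'⟩ := key hxy.symm
  have hm'' := hm'.symm hxy.symm hv
  by_contra hcon
  have huy : u ≠ h y := fun huy => hcon (huy ▸ hu)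
  have hvu : Y.graph.Side v (h y) u := by
    by_contra hvu
    exact huy (Y.isTree.side_cross hv.symm hu ((hm'' x).1 .self) hvu).2
  have hle : Y.stab u ≤ Y.stab (h x) := by
    intro γ (hγ : Y.smul γ u = u)
    change Y.smul γ (h x) = h x
    have hadj := Y.smul_adj γ hu
    rw [hγ, ← hh.1] at hadj
    rw [← hh.1]
    by_cases hγx : X.graph.Side x y (X.smul γ x)
    · exact (Y.isTree.side_cross hu hadj ((hm _).1 hγx) (Y.isTree.not_side hu)).1
    · exfalso
      obtain ⟨rfl, hγy⟩ := Y.isTree.side_cross hv.symm hadj.symm hvu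
        fun hγ => hγx ((hm'' _).2 hγ)
      have hγy := hh.injective hγy
      have hm₃ := hm.smul hh hxy hu γ
      have hxy' := X.smul_adj γ hxy
      rw [hγ, ← hh.1, hγy] at hm₃
      rw [hγy] at hxy'
      exact X.no_inversions γ x y hxy ⟨hγy, (hm'.eq hm₃ hxy.symm hxy').2⟩
  obtain ⟨γ, hγ⟩ := hY.exists_smul_eq hu.symm hle
  have hux : u = h (X.smul γ⁻¹ x) := by rw [hh.1, inv_smul_eq hγ]
  rw [hux] at hvu
  have := (hm _).1 ((hm'' _).2 hvu)
  rw [← hux] at this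
  exact Y.isTree.not_side hu this

theorem IsSeparating.exists_isGIso (hh : IsSeparating X Y h)
    (hY : Y.Reduced) : ∃ φ : Y.V → X.V, IsGIso Y X φ := by
  have hadj : ∀ {x u}, Y.graph.Adj (h x) u → ∃ y, X.graph.Adj x y ∧ h y = u := by
    intro x u hu
    obtain ⟨y, hxy, hm⟩ := hh.exists_matches hY hu
    exact ⟨y, hxy, (Y.isTree.side_cross hu (hh.adj hY hxy) .self
      fun hy => X.isTree.not_side hxy ((hm y).2 hy)).2⟩
  have hsurj : Function.Surjective h := by
    obtain ⟨x⟩ := X.isTree.connected.nonempty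
    intro u
    by_contra hu
    obtain ⟨_, d, -, hcd, ⟨z, rfl⟩, hd⟩ :=
      (Y.isTree.connected.preconnected (h x) u).exists_adj_of_not (P := (· ∈ Set.range h))
        ⟨x, rfl⟩ hu
    obtain ⟨y, -, hy⟩ := hadj hcd
    exact hd ⟨y, hy⟩
  let f := Equiv.ofBijective h ⟨hh.injective, hsurj⟩
  have hf : ∀ x, h (f.symm x) = x := f.apply_symm_apply
  refine ⟨f.symm, f.symm.bijective, fun u v => ⟨fun huv => ?_, fun huv => ?_⟩, fun γ u => ?_⟩
  · rw [← hf u] at huv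
    obtain ⟨y, hy, rfl⟩ := hadj huv
    rwa [show f.symm (h y) = y from f.symm_apply_apply y]
  · simpa only [hf] using hh.adj hY huv
  · apply hh.injective
    rw [hf, hh.1, hf]

end

end GTree

open GTree in
/-- Part of Theorem 5.17: let `X` be a strongly slide-free cocompact `G`-tree
and let `Y` be a cocompact `G`-tree obtained from `X` by an elementary
deformation.  Then `Y` is uniquely reducible to `X`: every maximal sequence of
collapse moves performed on `Y` (i.e. a sequence of collapse moves ending at a
reduced `G`-tree `Z`) results in a `G`-tree isomorphic to `X`. -/
theorem uniquely_reducible {G : Type u} [Group G] (X Y : GTree G)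
    (hXc : X.Cocompact) (hYc : Y.Cocompact)
    (hssf : X.StronglySlideFree)
    (hdef : ElemDeformation X Y) :
    ∀ Z : GTree G, Relation.ReflTransGen Collapse Y Z → Z.Reduced →
      ∃ φ : Z.V → X.V, IsGIso Z X φ := by
  intro Z hYZ hZ
  have hXZ : ElemDeformation X Z := by
    clear hZ
    induction hYZ with
    | refl => exact hdef
    | tail _ h ih => exact ih.trans _ _ _ (.rel _ _ h)
  obtain ⟨h, hh⟩ := hXZ.exists_isSeparating hssf
  exact hh.exists_isGIso hZ
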